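/- An ℵ₀-tangle τ of G is a closed subset of the topological space S⃗ if and only if there is an ℵ₀-block K of G such that τ = {(A,B) ∈ S⃗ : K ⊆ B}. -/

import Mathlib

open Set

variable {V : Type*}

/-- `{A,B}` is a separation of `G`: `A ∪ B = V` and no edge between `A∖B` and `B∖A`. -/
def IsSep (G : SimpleGraph V) (A B : Set V) : Prop :=
  A ∪ B = Set.univ ∧ ∀ a ∈ A \ B, ∀ b ∈ B \ A, ¬ G.Adj a b

/-- A separation of finite order. -/
def IsFinSep (G : SimpleGraph V) (A B : Set V) : Prop :=
  IsSep G A B ∧ (A ∩ B).Finite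

/-- The set `S⃗` of oriented finite-order separations of `G`, as ordered pairs. -/
def Svec (G : SimpleGraph V) : Set (Set V × Set V) :=
  {p | IsFinSep G p.1 p.2}

/-- `(A,B) ≤ (C,D)` iff `A ⊆ C` and `D ⊆ B`. -/
def sepLE (p q : Set V × Set V) : Prop :=
  p.1 ⊆ q.1 ∧ q.2 ⊆ p.2

/-- An orientation of the set `S` of finite-order separations: a subset of `S⃗` containing
exactly one of `(A,B)`, `(B,A)` for every finite-order separation `{A,B}`. -/
def IsOrientation (G : SimpleGraph V) (O : Set (Set V × Set V)) : Prop :=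
  O ⊆ Svec G ∧ ∀ A B : Set V, IsFinSep G A B → ((A, B) ∈ O ↔ (B, A) ∉ O)

/-- Consistency: no two distinct members `(B,A)`, `(C,D)` with `(A,B) < (C,D)`. -/
def Consistent (O : Set (Set V × Set V)) : Prop :=
  ∀ A B C D : Set V, (B, A) ∈ O → (C, D) ∈ O → (B, A) ≠ (C, D) →
    ¬ (sepLE (A, B) (C, D) ∧ (A, B) ≠ (C, D))

/-- A star in `S⃗`: every two distinct elements point towards each other. -/
def IsStar (G : SimpleGraph V) (σ : Set (Set V × Set V)) : Prop :=
  σ ⊆ Svec G ∧ ∀ p ∈ σ, ∀ q ∈ σ, p ≠ q → sepLE p (q.2, q.1)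

/-- Membership in `T_n`: a star of at most `n` elements whose target sides have finite
intersection. -/
def InTn (G : SimpleGraph V) (n : ℕ) (σ : Set (Set V × Set V)) : Prop :=
  IsStar G σ ∧ σ.Finite ∧ σ.ncard ≤ n ∧ (⋂ p ∈ σ, p.2).Finite

/-- Membership in `T`: an arbitrary star whose target sides have finite intersection. -/
def InT (G : SimpleGraph V) (σ : Set (Set V × Set V)) : Prop :=
  IsStar G σ ∧ (⋂ p ∈ σ, p.2).Finite

/-- An `ℵ₀`-tangle of `G`: a consistent orientation of `S` with no subset in `T₃`. -/
def IsTangle (G : SimpleGraph V) (τ : Set (Set V × Set V)) : Prop :=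
  IsOrientation G τ ∧ Consistent τ ∧ ∀ σ ⊆ τ, ¬ InTn G 3 σ

/-- A `T`-tangle of `S`: a consistent orientation of `S` with no subset in `T`. -/
def IsTTangle (G : SimpleGraph V) (τ : Set (Set V × Set V)) : Prop :=
  IsOrientation G τ ∧ Consistent τ ∧ ∀ σ ⊆ τ, ¬ InT G σ

/-- The set `𝒞_X` of (vertex sets of) connected components of `G − X`. -/
def Comps (G : SimpleGraph V) (X : Set V) : Set (Set V) :=
  {C | ∃ c : (G.induce Xᶜ).ConnectedComponent, C = Subtype.val '' c.supp}

/-- A collection of subsets of `α` is an ultrafilter on `α`. -/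
def IsUltra {α : Type*} (F : Set (Set α)) : Prop :=
  ∅ ∉ F ∧ (∀ s ∈ F, ∀ t ∈ F, s ∩ t ∈ F) ∧ (∀ s ∈ F, ∀ t : Set α, s ⊆ t → t ∈ F) ∧
    ∀ s : Set α, s ∈ F ∨ sᶜ ∈ F

/-- A principal ultrafilter, generated by a single point. -/
def IsPrincipalUF {α : Type*} (F : Set (Set α)) : Prop :=
  ∃ a : α, F = {s | a ∈ s}

/-- `U(τ,X)`: the collection of all sets `𝒮` of components of `G − X` with
`(⋃(𝒞_X∖𝒮) ∪ X, ⋃𝒮 ∪ X) ∈ τ`. -/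
def tangleUF (G : SimpleGraph V) (τ : Set (Set V × Set V)) (X : Set V) :
    Set (Set ↥(Comps G X)) :=
  {𝒮 | ((⋃ C ∈ 𝒮ᶜ, (C : Set V)) ∪ X, (⋃ C ∈ 𝒮, (C : Set V)) ∪ X) ∈ τ}

/-- `f_{X',X}`: the pushforward of an ultrafilter on `𝒞_{X'}` along the map sending each
component of `G − X'` to the component of `G − X` containing it. -/
def pushUF (G : SimpleGraph V) (X X' : Set V) (F : Set (Set ↥(Comps G X'))) :
    Set (Set ↥(Comps G X)) :=
  {𝒮 | {C' : ↥(Comps G X') | ∃ C ∈ 𝒮, (C' : Set V) ⊆ (C : Set V)} ∈ F}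

/-- A direction in `G`: a choice of a component of `G − X` for every finite `X ⊆ V`,
compatible under inclusion. -/
def IsDirection (G : SimpleGraph V) (f : Set V → Set V) : Prop :=
  (∀ X : Set V, X.Finite → f X ∈ Comps G X) ∧
    ∀ X X' : Set V, X.Finite → X'.Finite → X ⊆ X' → f X' ⊆ f X

/-- The space `S⃗` of oriented finite-order separations of `G`. -/
abbrev SvecT (G : SimpleGraph V) : Type _ := {p : Set V × Set V // IsFinSep G p.1 p.2}

/-- The topology on `S⃗` with basic open sets `O(A_Z,B_Z)`, for `Z ⊆ V` finite and
`A_Z ∪ B_Z = Z`, consisting of all `(A,B) ∈ S⃗` with `A ∩ Z = A_Z` and `B ∩ Z = B_Z`. -/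
def sepTopology (G : SimpleGraph V) : TopologicalSpace (SvecT G) :=
  TopologicalSpace.generateFrom
    {O : Set (SvecT G) | ∃ Z AZ BZ : Set V, Z.Finite ∧ AZ ∪ BZ = Z ∧
        O = {p : SvecT G | p.1.1 ∩ Z = AZ ∧ p.1.2 ∩ Z = BZ}}

/-- A `(<ℵ₀)`-inseparable set of vertices: an infinite set no two of whose elements can be
separated in `G` by a finite set of other vertices. -/
def Insep (G : SimpleGraph V) (K : Set V) : Prop :=
  K.Infinite ∧ ∀ u ∈ K, ∀ v ∈ K, u ≠ v → ∀ W : Set V, W.Finite → u ∉ W → v ∉ W →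
    ∃ C ∈ Comps G W, u ∈ C ∧ v ∈ C

/-- An `ℵ₀`-block of `G`: a maximal `(<ℵ₀)`-inseparable set of vertices. -/
def IsBlock (G : SimpleGraph V) (K : Set V) : Prop :=
  Insep G K ∧ ∀ K' : Set V, Insep G K' → K ⊆ K' → K' = K

theorem IsFinSep.symm {G : SimpleGraph V} {A B : Set V} (h : IsFinSep G A B) :
    IsFinSep G B A :=
  ⟨⟨by rw [union_comm]; exact h.1.1, fun a ha b hb hab => h.1.2 b hb a ha hab.symm⟩,
    by rw [inter_comm]; exact h.2⟩

theorem isFinSep_univ_left (G : SimpleGraph V) {X : Set V} (hX : X.Finite) :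
    IsFinSep G univ X :=
  ⟨⟨univ_union X, fun _ _ b hb => absurd (mem_univ b) hb.2⟩, by rwa [univ_inter]⟩

/-- The supremum of two separations of finite order is again one. -/
theorem IsFinSep.sup {G : SimpleGraph V} {A B A' B' : Set V} (h : IsFinSep G A B)
    (h' : IsFinSep G A' B') : IsFinSep G (A ∪ A') (B ∩ B') := by
  obtain ⟨⟨hU, hE⟩, hF⟩ := h
  obtain ⟨⟨hU', hE'⟩, hF'⟩ := h'
  have mem : ∀ x, x ∈ A ∨ x ∈ B := fun x => (hU ▸ mem_univ x : x ∈ A ∪ B)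
  have mem' : ∀ x, x ∈ A' ∨ x ∈ B' := fun x => (hU' ▸ mem_univ x : x ∈ A' ∪ B')
  refine ⟨⟨?_, ?_⟩, (hF.union hF').subset ?_⟩
  · ext x
    have := mem x
    have := mem' x
    simp only [mem_union, mem_inter_iff, mem_univ, iff_true]
    tauto
  · rintro a ⟨-, haB⟩ b ⟨⟨hbB, hbB'⟩, hbA⟩ hab
    simp only [mem_union, not_or] at hbA
    rcases not_and_or.mp haB with ha | ha
    · exact hE a ⟨(mem a).resolve_right ha, ha⟩ b ⟨hbB, hbA.1⟩ hab
    · exact hE' a ⟨(mem' a).resolve_right ha, ha⟩ b ⟨hbB', hbA.2⟩ hab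
  · rintro x ⟨hA | hA, hB, hB'⟩
    exacts [Or.inl ⟨hA, hB⟩, Or.inr ⟨hA, hB'⟩]

/-- The infimum of two separations of finite order is again one. -/
theorem IsFinSep.inf {G : SimpleGraph V} {A B A' B' : Set V} (h : IsFinSep G A B)
    (h' : IsFinSep G A' B') : IsFinSep G (A ∩ A') (B ∪ B') :=
  (h.symm.sup h'.symm).symm

theorem IsTangle.mem_or_swap_mem {G : SimpleGraph V} {τ : Set (Set V × Set V)}
    (hτ : IsTangle G τ) {A B : Set V} (h : IsFinSep G A B) : (A, B) ∈ τ ∨ (B, A) ∈ τ := by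
  by_cases hBA : (B, A) ∈ τ
  exacts [Or.inr hBA, Or.inl ((hτ.1.2 A B h).2 hBA)]

theorem IsTangle.infinite_right {G : SimpleGraph V} {τ : Set (Set V × Set V)}
    (hτ : IsTangle G τ) {A B : Set V} (h : (A, B) ∈ τ) : B.Infinite := by
  intro hB
  refine hτ.2.2 {(A, B)} (singleton_subset_iff.2 h)
    ⟨⟨singleton_subset_iff.2 (hτ.1.1 h), ?_⟩, finite_singleton _, ?_, ?_⟩
  · rintro p rfl q rfl hpq
    exact absurd rfl hpq
  · simp
  · simpa using hB

theorem IsTangle.mem_of_le {G : SimpleGraph V} {τ : Set (Set V × Set V)}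
    (hτ : IsTangle G τ) {A B A' B' : Set V} (h : (A', B') ∈ τ) (hs : IsFinSep G A B)
    (hA : A ⊆ A') (hB : B' ⊆ B) : (A, B) ∈ τ := by
  refine (hτ.mem_or_swap_mem hs).elim id fun hBA => ?_
  by_cases heq : (A, B) = (A', B')
  · exact heq ▸ h
  refine absurd ⟨⟨hA, hB⟩, heq⟩ (hτ.2.1 A B A' B' hBA h ?_)
  rintro ⟨⟩
  exact hτ.infinite_right h ((hτ.1.1 h).2.subset fun x hx => ⟨hB hx, hx⟩)

/-- A tangle is closed under suprema of pairs. -/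
theorem IsTangle.sup_mem {G : SimpleGraph V} {τ : Set (Set V × Set V)}
    (hτ : IsTangle G τ) {A B A' B' : Set V} (h : (A, B) ∈ τ) (h' : (A', B') ∈ τ) :
    (A ∪ A', B ∩ B') ∈ τ := by
  have hs : IsFinSep G A B := hτ.1.1 h
  have hs' : IsFinSep G A' B' := hτ.1.1 h'
  refine (hτ.mem_or_swap_mem (hs.sup hs')).elim id fun hsw => False.elim ?_
  have hinf : (B ∩ A', A ∪ B') ∈ τ :=
    hτ.mem_of_le h' (hs.symm.inf hs') inter_subset_right subset_union_right
  have hsub : ({(A, B), (B ∩ A', A ∪ B'), (B ∩ B', A ∪ A')} : Set (Set V × Set V)) ⊆ τ := by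
    rintro p (rfl | rfl | rfl) <;> assumption
  refine hτ.2.2 _ hsub ⟨⟨hsub.trans hτ.1.1, ?_⟩, by simp, ?_, ?_⟩
  · rintro p (rfl | rfl | rfl) q (rfl | rfl | rfl) hpq <;>
      first
      | exact absurd rfl hpq
      | (constructor <;> intro x <;> simp only [mem_union, mem_inter_iff] <;> tauto)
  · exact (ncard_insert_le _ _).trans (Nat.succ_le_succ ((ncard_insert_le _ _).trans (by simp)))
  · refine (hs.2.union hs'.2).subset fun x hx => ?_
    simp only [mem_insert_iff, mem_singleton_iff, iInter_iInter_eq_or_left,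
      iInter_iInter_eq_left, mem_inter_iff, mem_union] at hx ⊢
    tauto

theorem IsTangle.finite_univ_mem [Infinite V] {G : SimpleGraph V} {τ : Set (Set V × Set V)}
    (hτ : IsTangle G τ) {X : Set V} (hX : X.Finite) : (X, univ) ∈ τ :=
  (hτ.mem_or_swap_mem (isFinSep_univ_left G hX)).elim
    (fun h => absurd hX (hτ.infinite_right h)) id

/-- The set of vertices lying on the target side of every element of `τ`. -/
def tangleCore (τ : Set (Set V × Set V)) : Set V := ⋂ p ∈ τ, p.2

theorem tangleCore_subset {τ : Set (Set V × Set V)} {A B : Set V} (h : (A, B) ∈ τ) :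
    tangleCore τ ⊆ B :=
  biInter_subset_of_mem (t := fun p : Set V × Set V => p.2) h

theorem exists_mem_of_notMem_tangleCore {τ : Set (Set V × Set V)} {v : V}
    (hv : v ∉ tangleCore τ) : ∃ A B, (A, B) ∈ τ ∧ v ∉ B := by
  simp only [tangleCore, mem_iInter, not_forall] at hv
  obtain ⟨⟨A, B⟩, h, hv⟩ := hv
  exact ⟨A, B, h, hv⟩

/-- On every finite set, some element of a tangle agrees with `(V, K)`, where `K` is the core. -/
theorem IsTangle.exists_mem_agree_core [Infinite V] {G : SimpleGraph V}
    {τ : Set (Set V × Set V)} (hτ : IsTangle G τ) {Z : Set V} (hZ : Z.Finite) :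
    ∃ A B, (A, B) ∈ τ ∧ Z ⊆ A ∧ B ∩ Z = tangleCore τ ∩ Z := by
  suffices h : ∃ A B, (A, B) ∈ τ ∧ Z ⊆ A ∧ B ∩ Z ⊆ tangleCore τ by
    obtain ⟨A, B, hAB, hA, hB⟩ := h
    exact ⟨A, B, hAB, hA, (subset_inter hB inter_subset_right).antisymm
      (inter_subset_inter_left Z (tangleCore_subset hAB))⟩
  induction Z, hZ using Set.Finite.induction_on with
  | empty => exact ⟨∅, univ, hτ.finite_univ_mem finite_empty, by simp, by simp⟩
  | @insert v Z _ _ ih =>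
    obtain ⟨A, B, hAB, hA, hB⟩ := ih
    obtain ⟨A', B', hAB', hA', hB'⟩ :
        ∃ A' B', (A', B') ∈ τ ∧ v ∈ A' ∧ (v ∈ B' → v ∈ tangleCore τ) := by
      by_cases hv : v ∈ tangleCore τ
      · exact ⟨{v}, univ, hτ.finite_univ_mem (finite_singleton v), rfl, fun _ => hv⟩
      · obtain ⟨A', B', h, hvB⟩ := exists_mem_of_notMem_tangleCore hv
        have hmem : v ∈ A' ∪ B' := (hτ.1.1 h).1.1 ▸ mem_univ v
        exact ⟨A', B', h, hmem.resolve_right hvB, fun h => absurd h hvB⟩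
    refine ⟨_, _, hτ.sup_mem hAB hAB', ?_, ?_⟩
    · exact insert_subset (Or.inr hA') (hA.trans subset_union_left)
    · rintro x ⟨⟨hxB, hxB'⟩, rfl | hxZ⟩
      exacts [hB' hxB', hB ⟨hxB, hxZ⟩]

/-- Every open neighbourhood contains all separations that agree with its centre on some
finite set. -/
theorem exists_finite_agree_of_isOpen {G : SimpleGraph V} {U : Set (SvecT G)}
    (hU : @IsOpen (SvecT G) (sepTopology G) U) {q : SvecT G} (hq : q ∈ U) :
    ∃ Z : Set V, Z.Finite ∧ ∀ p : SvecT G,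
      p.1.1 ∩ Z = q.1.1 ∩ Z → p.1.2 ∩ Z = q.1.2 ∩ Z → p ∈ U := by
  induction hU with
  | basic O hO =>
    obtain ⟨Z, AZ, BZ, hZ, -, rfl⟩ := hO
    exact ⟨Z, hZ, fun p h₁ h₂ => ⟨h₁.trans hq.1, h₂.trans hq.2⟩⟩
  | univ => exact ⟨∅, finite_empty, fun _ _ _ => mem_univ _⟩
  | inter O O' _ _ ih ih' =>
    obtain ⟨Z, hZ, h⟩ := ih hq.1
    obtain ⟨Z', hZ', h'⟩ := ih' hq.2
    have restrict : ∀ {A B X : Set V}, X ⊆ Z ∪ Z' → A ∩ (Z ∪ Z') = B ∩ (Z ∪ Z') →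
        A ∩ X = B ∩ X := fun {A B X} hX hAB => by
      rw [← inter_eq_self_of_subset_right hX, ← inter_assoc, hAB, inter_assoc]
    exact ⟨Z ∪ Z', hZ.union hZ', fun p h₁ h₂ =>
      ⟨h p (restrict subset_union_left h₁) (restrict subset_union_left h₂),
        h' p (restrict subset_union_right h₁) (restrict subset_union_right h₂)⟩⟩
  | sUnion 𝒪 _ ih =>
    obtain ⟨O, hO, hqO⟩ := hq
    obtain ⟨Z, hZ, h⟩ := ih O hO hqO
    exact ⟨Z, hZ, fun p h₁ h₂ => ⟨O, hO, h p h₁ h₂⟩⟩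

theorem isClosed_setOf_subset_right (G : SimpleGraph V) (K : Set V) :
    @IsClosed (SvecT G) (sepTopology G) {p : SvecT G | K ⊆ p.1.2} := by
  let := sepTopology G
  have heq : {p : SvecT G | K ⊆ p.1.2} =
      ⋂ v ∈ K, {p : SvecT G | p.1.1 ∩ {v} = {v} ∧ p.1.2 ∩ {v} = ∅}ᶜ := by
    ext p
    simp only [mem_ofPred_eq, mem_iInter, mem_compl_iff, not_and, inter_singleton_eq_empty,
      not_not]
    refine ⟨fun h v hv _ => h hv, fun h v hv => ?_⟩
    by_contra hvB
    have hmem : v ∈ p.1.1 ∪ p.1.2 := p.2.1.1 ▸ mem_univ v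
    exact hvB (h v hv (inter_eq_self_of_subset_right
      (singleton_subset_iff.2 (hmem.resolve_right hvB))))
  rw [heq]
  exact isClosed_biInter fun v _ => IsOpen.isClosed_compl <|
    TopologicalSpace.isOpen_generateFrom_of_mem
      ⟨{v}, {v}, ∅, finite_singleton v, union_empty _, rfl⟩

/-- A component `C` of `G - W` gives the separation `(C ∪ W, V ∖ C)`. -/
theorem isFinSep_of_mem_comps {G : SimpleGraph V} {W C : Set V} (hW : W.Finite)
    (hC : C ∈ Comps G W) : IsFinSep G (C ∪ W) Cᶜ := by
  obtain ⟨c, rfl⟩ := hC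
  refine ⟨⟨?_, ?_⟩, hW.subset ?_⟩
  · rw [union_right_comm, union_compl_self, univ_union]
  · rintro a ⟨-, ha⟩ b ⟨hb, hbCW⟩ hab
    obtain ⟨a, hac, rfl⟩ := not_not.1 ha
    refine hb ⟨⟨b, fun hbW => hbCW (Or.inr hbW)⟩, ?_, rfl⟩
    exact c.mem_supp_of_adj_mem_supp hac hab
  · rintro x ⟨hx | hx, hxC⟩
    exacts [absurd hx hxC, hx]

/-- A separation `(A, B)` separates `A ∖ B` from `B ∖ A` in `G - (A ∩ B)`. -/
theorem IsSep.notMem_of_mem_comps {G : SimpleGraph V} {A B C : Set V} (h : IsSep G A B)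
    (hC : C ∈ Comps G (A ∩ B)) {u v : V} (hu : u ∈ A \ B) (huC : u ∈ C) (hv : v ∈ B \ A) :
    v ∉ C := by
  obtain ⟨c, rfl⟩ := hC
  rintro ⟨v, hvc, rfl⟩
  obtain ⟨u, huc, rfl⟩ := huC
  obtain ⟨w⟩ := SimpleGraph.ConnectedComponent.exact
    (((SimpleGraph.ConnectedComponent.mem_supp_iff c u).1 huc).trans
      ((SimpleGraph.ConnectedComponent.mem_supp_iff c v).1 hvc).symm)
  clear huc hvc
  induction w with
  | nil => exact hv.2 hu.1
  | @cons x y z hxy _ ih =>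
    refine ih hv ?_
    by_contra hy
    have hmem : (y : V) ∈ A ∪ B := h.1 ▸ mem_univ _
    have hyW : (y : V) ∉ A ∩ B := y.2
    simp only [mem_sdiff, mem_union, mem_inter_iff] at hy hmem hyW
    exact h.2 x hu y (by simp only [mem_sdiff]; tauto) hxy

theorem IsTangle.core_infinite_of_isClosed [Infinite V] {G : SimpleGraph V}
    {τ : Set (Set V × Set V)} (hτ : IsTangle G τ)
    (hcl : @IsClosed (SvecT G) (sepTopology G) {p : SvecT G | p.1 ∈ τ}) :
    (tangleCore τ).Infinite := by
  intro hK
  have hq : (univ, tangleCore τ) ∉ τ := fun h => hτ.infinite_right h hK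
  obtain ⟨Z, hZ, h⟩ := exists_finite_agree_of_isOpen
    (@IsClosed.isOpen_compl _ (sepTopology G) _ hcl)
    (q := ⟨(univ, tangleCore τ), isFinSep_univ_left G hK⟩) hq
  obtain ⟨A, B, hAB, hA, hB⟩ := hτ.exists_mem_agree_core hZ
  exact h ⟨(A, B), hτ.1.1 hAB⟩
    (by rw [univ_inter]; exact inter_eq_self_of_subset_right hA) hB hAB

theorem IsTangle.core_insep {G : SimpleGraph V} {τ : Set (Set V × Set V)} (hτ : IsTangle G τ)
    (hK : (tangleCore τ).Infinite) : Insep G (tangleCore τ) := by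
  refine ⟨hK, fun u hu v hv _ W hW huW hvW => ?_⟩
  let c := (G.induce Wᶜ).connectedComponentMk ⟨u, huW⟩
  have hC : Subtype.val '' c.supp ∈ Comps G W := ⟨c, rfl⟩
  have huC : u ∈ Subtype.val '' c.supp := ⟨⟨u, huW⟩, rfl, rfl⟩
  refine ⟨_, hC, huC, ?_⟩
  rcases hτ.mem_or_swap_mem (isFinSep_of_mem_comps hW hC) with h | h
  · exact absurd huC (tangleCore_subset h hu)
  · exact (tangleCore_subset h hv).resolve_right hvW

theorem IsTangle.core_isBlock {G : SimpleGraph V} {τ : Set (Set V × Set V)} (hτ : IsTangle G τ)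
    (hK : (tangleCore τ).Infinite) : IsBlock G (tangleCore τ) := by
  refine ⟨hτ.core_insep hK, fun K' hK' hsub => Subset.antisymm (fun v hv => ?_) hsub⟩
  by_contra hvK
  obtain ⟨A, B, hAB, hvB⟩ := exists_mem_of_notMem_tangleCore hvK
  have hs : IsFinSep G A B := hτ.1.1 hAB
  have hvA : v ∈ A := (hs.1.1 ▸ mem_univ v : v ∈ A ∪ B).resolve_right hvB
  obtain ⟨u, huK, hu⟩ := hK.exists_notMem_finite hs.2
  have huB : u ∈ B := tangleCore_subset hAB huK
  have huA : u ∉ A := fun h => hu ⟨h, huB⟩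
  obtain ⟨C, hC, hvC, huC⟩ := hK'.2 v hv u (hsub huK) (fun h => huA (h ▸ hvA)) (A ∩ B) hs.2
    (fun h => hvB h.2) hu
  exact hs.1.notMem_of_mem_comps hC ⟨hvA, hvB⟩ hvC ⟨huB, huA⟩ huC

theorem IsTangle.eq_setOf_core_subset {G : SimpleGraph V} {τ : Set (Set V × Set V)}
    (hτ : IsTangle G τ) (hK : (tangleCore τ).Infinite) :
    τ = {p ∈ Svec G | tangleCore τ ⊆ p.2} := by
  ext ⟨A, B⟩
  refine ⟨fun h => ⟨hτ.1.1 h, tangleCore_subset h⟩, fun ⟨hs, hB⟩ => ?_⟩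
  exact (hτ.mem_or_swap_mem hs).elim id fun h =>
    absurd (hs.2.subset (subset_inter (tangleCore_subset h) hB)) hK

/-- Theorem 4: an `ℵ₀`-tangle `τ` of `G` is closed in the space `S⃗` iff
`τ = {(A,B) ∈ S⃗ : K ⊆ B}` for some `ℵ₀`-block `K` of `G`. -/
theorem stmt19 [Infinite V] (G : SimpleGraph V) (τ : Set (Set V × Set V))
    (hτ : IsTangle G τ) :
    @IsClosed (SvecT G) (sepTopology G) {p : SvecT G | p.1 ∈ τ} ↔
      ∃ K : Set V, IsBlock G K ∧ τ = {p ∈ Svec G | K ⊆ p.2} := by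
  constructor
  · intro hcl
    have hK := hτ.core_infinite_of_isClosed hcl
    exact ⟨tangleCore τ, hτ.core_isBlock hK, hτ.eq_setOf_core_subset hK⟩
  · rintro ⟨K, -, hK⟩
    convert isClosed_setOf_subset_right G K using 1
    ext p
    rw [hK]
    exact ⟨fun h => h.2, fun h => ⟨p.2, h⟩⟩
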